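/- Let Δ = Δ_0 + Δ_1 + ⋯ + Δ_k be a Minkowski sum decomposition of a reflexive polytope Δ ⊂ ℝ^d into lattice polytopes. Define ∇̂_0 = Conv({u − Σ_{i=1}^k min⟨Δ_i,u⟩ e_i* : u ∈ Δ*} ∪ {e_1*, …, e_k*}) ⊂ ℝ^d ⊕ ℝ^k, ∇̂_i = ∇̂_0 − e_i* for i = 1,…,k, and Δ̃_i = Conv((Δ_i + e_i) ∪ {0}) ⊂ ℝ^d ⊕ ℝ^k for i = 0,…,k (with e_0 = −(e_1+⋯+e_k)). Then ∇̂_0 + ⋯ + ∇̂_k is a reflexive polytope in ℝ^d ⊕ ℝ^k and the decomposition ∇̂_0 + ⋯ + ∇̂_k is a nef-partition whose dual nef-partition is Δ̃_0 + ⋯ + Δ̃_k; moreover (∇̂_0 ⊎ ⋯ ⊎ ∇̂_k)* = Δ̃_0 + ⋯ + Δ̃_k and (Δ̃_0 ⊎ ⋯ ⊎ Δ̃_k)* = ∇̂_0 + ⋯ + ∇̂_k. -/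

import Mathlib

open scoped Pointwise
open Set

noncomputable section

/-- The standard pairing on `ℝ^n`. -/
def pairing {n : ℕ} (x y : Fin n → ℝ) : ℝ := ∑ i, x i * y i

/-- A point of `ℝ^n` lying in the lattice `ℤ^n`. -/
def IsLatticePt {n : ℕ} (x : Fin n → ℝ) : Prop := ∀ i, ∃ z : ℤ, x i = (z : ℝ)

/-- A lattice polytope: the convex hull of finitely many lattice points. -/
def IsLatticePolytope {n : ℕ} (P : Set (Fin n → ℝ)) : Prop :=
  ∃ S : Set (Fin n → ℝ), S.Finite ∧ (∀ x ∈ S, IsLatticePt x) ∧ P = convexHull ℝ S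

/-- The dual polytope `P* = {y | ⟨x,y⟩ ≥ -1 ∀ x ∈ P}`. -/
def polarDual {n : ℕ} (P : Set (Fin n → ℝ)) : Set (Fin n → ℝ) :=
  {y | ∀ x ∈ P, -1 ≤ pairing x y}

/-- A reflexive polytope. -/
def IsReflexive {n : ℕ} (P : Set (Fin n → ℝ)) : Prop :=
  IsLatticePolytope P ∧ (0 : Fin n → ℝ) ∈ interior P ∧ IsLatticePolytope (polarDual P)

/-- `min⟨P, u⟩ = min_{x ∈ P} ⟨x, u⟩`. -/
def minPair {n : ℕ} (P : Set (Fin n → ℝ)) (u : Fin n → ℝ) : ℝ :=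
  sInf ((fun x => pairing x u) '' P)

/-- The real vector space `ℝ^d ⊕ ℝ^k`. -/
abbrev Vdk (d k : ℕ) := (Fin d → ℝ) × (Fin k → ℝ)

/-- The pairing on `ℝ^d ⊕ ℝ^k` (sum of the two standard pairings). -/
def pairingV {d k : ℕ} (x y : Vdk d k) : ℝ := pairing x.1 y.1 + pairing x.2 y.2

def IsLatticePtV {d k : ℕ} (x : Vdk d k) : Prop := IsLatticePt x.1 ∧ IsLatticePt x.2

def IsLatticePolytopeV {d k : ℕ} (P : Set (Vdk d k)) : Prop :=
  ∃ S : Set (Vdk d k), S.Finite ∧ (∀ x ∈ S, IsLatticePtV x) ∧ P = convexHull ℝ S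

def polarDualV {d k : ℕ} (P : Set (Vdk d k)) : Set (Vdk d k) :=
  {y | ∀ x ∈ P, -1 ≤ pairingV x y}

def IsReflexiveV {d k : ℕ} (P : Set (Vdk d k)) : Prop :=
  IsLatticePolytopeV P ∧ (0 : Vdk d k) ∈ interior P ∧ IsLatticePolytopeV (polarDualV P)

/-- The Cayley cone `σ̄ = {(t₀Δ₀ + ⋯ + t_kΔ_k, t₀, …, t_k) : tᵢ ≥ 0} ⊆ ℝ^d ⊕ ℝ^{k+1}`. -/
def cayleyCone {d k : ℕ} (Δ : Fin (k+1) → Set (Fin d → ℝ)) : Set (Vdk d (k+1)) :=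
  {p | (∀ i, 0 ≤ p.2 i) ∧ p.1 ∈ ∑ i, p.2 i • Δ i}

/-- The dual cone of a cone in `ℝ^d ⊕ ℝ^k`. -/
def dualConeV {d k : ℕ} (σ : Set (Vdk d k)) : Set (Vdk d k) :=
  {y | ∀ x ∈ σ, 0 ≤ pairingV x y}

/-- `e₀ = −(e₁ + ⋯ + e_k)`, `eᵢ` the standard basis of the second factor `ℝ^k`. -/
def evec {k : ℕ} : Fin (k+1) → Fin k → ℝ :=
  Fin.cases (fun _ => -1) (fun i => Pi.single i 1)

/-! ### The pairings -/

lemma pairing_eq_dotProduct {n : ℕ} (x y : Fin n → ℝ) : pairing x y = x ⬝ᵥ y := rfl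

lemma pairing_add_left {n : ℕ} (x y u : Fin n → ℝ) :
    pairing (x + y) u = pairing x u + pairing y u := add_dotProduct x y u

lemma pairing_smul_left {n : ℕ} (c : ℝ) (x u : Fin n → ℝ) :
    pairing (c • x) u = c * pairing x u := smul_dotProduct c x u

lemma pairing_sum_left {n : ℕ} {ι : Type*} (s : Finset ι) (x : ι → Fin n → ℝ) (u : Fin n → ℝ) :
    pairing (∑ i ∈ s, x i) u = ∑ i ∈ s, pairing (x i) u := sum_dotProduct s x u

lemma pairing_comm {n : ℕ} (x u : Fin n → ℝ) : pairing x u = pairing u x := dotProduct_comm x u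

lemma pairing_add_right {n : ℕ} (x u v : Fin n → ℝ) :
    pairing x (u + v) = pairing x u + pairing x v := dotProduct_add x u v

lemma pairing_smul_right {n : ℕ} (c : ℝ) (x u : Fin n → ℝ) :
    pairing x (c • u) = c * pairing x u := dotProduct_smul c x u

lemma pairing_sum_right {n : ℕ} {ι : Type*} (s : Finset ι) (x : Fin n → ℝ) (u : ι → Fin n → ℝ) :
    pairing x (∑ i ∈ s, u i) = ∑ i ∈ s, pairing x (u i) := dotProduct_sum x s u

lemma pairing_zero_left {n : ℕ} (u : Fin n → ℝ) : pairing 0 u = 0 := zero_dotProduct u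

lemma pairing_zero_right {n : ℕ} (x : Fin n → ℝ) : pairing x 0 = 0 := dotProduct_zero x

lemma pairingV_add_left {d k : ℕ} (x y u : Vdk d k) :
    pairingV (x + y) u = pairingV x u + pairingV y u := by
  simp only [pairingV, Prod.fst_add, Prod.snd_add, pairing_add_left]; ring

lemma pairingV_smul_left {d k : ℕ} (c : ℝ) (x u : Vdk d k) :
    pairingV (c • x) u = c * pairingV x u := by
  simp only [pairingV, Prod.smul_fst, Prod.smul_snd, pairing_smul_left]; ring

lemma pairingV_comm {d k : ℕ} (x u : Vdk d k) : pairingV x u = pairingV u x := by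
  simp only [pairingV, pairing_comm]

lemma pairingV_zero_left {d k : ℕ} (u : Vdk d k) : pairingV 0 u = 0 := by
  simp [pairingV, pairing_zero_left]

lemma pairingV_sub_left {d k : ℕ} (x y u : Vdk d k) :
    pairingV (x - y) u = pairingV x u - pairingV y u := by
  have := pairingV_add_left (x - y) y u
  rw [sub_add_cancel] at this
  linarith

lemma pairingV_sum_left {d k : ℕ} {ι : Type*} (s : Finset ι) (x : ι → Vdk d k) (u : Vdk d k) :
    pairingV (∑ i ∈ s, x i) u = ∑ i ∈ s, pairingV (x i) u := by
  simp only [pairingV, Prod.fst_sum, Prod.snd_sum, pairing_sum_left, Finset.sum_add_distrib]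

lemma continuous_pairing_left {n : ℕ} (u : Fin n → ℝ) : Continuous fun x => pairing x u := by
  unfold pairing; fun_prop

lemma continuous_pairingV_right {d k : ℕ} (x : Vdk d k) : Continuous fun y => pairingV x y := by
  unfold pairingV pairing; fun_prop

lemma exists_pairing_eq {n : ℕ} (f : (Fin n → ℝ) →ₗ[ℝ] ℝ) : ∃ u, ∀ x, f x = pairing x u :=
  ⟨_, fun x => f.pi_apply_eq_sum_univ x⟩

lemma exists_pairingV_eq {d k : ℕ} (f : Vdk d k →ₗ[ℝ] ℝ) : ∃ u, ∀ x, f x = pairingV x u := by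
  obtain ⟨u, hu⟩ := exists_pairing_eq (f ∘ₗ LinearMap.inl ℝ _ _)
  obtain ⟨t, ht⟩ := exists_pairing_eq (f ∘ₗ LinearMap.inr ℝ _ _)
  refine ⟨(u, t), fun x => ?_⟩
  simp only [pairingV, ← hu, ← ht, LinearMap.comp_apply, ← map_add]
  simp

lemma le_pairing_convexHull {n : ℕ} {S : Set (Fin n → ℝ)} {u : Fin n → ℝ} {c : ℝ}
    (h : ∀ x ∈ S, c ≤ pairing x u) {x : Fin n → ℝ} (hx : x ∈ convexHull ℝ S) :
    c ≤ pairing x u := by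
  refine convexHull_min (t := {x | c ≤ pairing x u}) h ?_ hx
  exact convex_halfSpace_ge
    ⟨fun x y => pairing_add_left x y u, fun a x => pairing_smul_left a x u⟩ c

lemma le_pairingV_convexHull {d k : ℕ} {S : Set (Vdk d k)} {u : Vdk d k} {c : ℝ}
    (h : ∀ x ∈ S, c ≤ pairingV x u) {x : Vdk d k} (hx : x ∈ convexHull ℝ S) :
    c ≤ pairingV x u := by
  refine convexHull_min (t := {x | c ≤ pairingV x u}) h ?_ hx
  exact convex_halfSpace_ge
    ⟨fun x y => pairingV_add_left x y u, fun a x => pairingV_smul_left a x u⟩ c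

lemma mem_of_forall_exists_pairing_le {n : ℕ} {C : Set (Fin n → ℝ)} (hC : Convex ℝ C)
    (hcl : IsClosed C) {m : Fin n → ℝ} (h : ∀ u, ∃ x ∈ C, pairing x u ≤ pairing m u) : m ∈ C := by
  by_contra hm
  obtain ⟨f, a, hfm, hfC⟩ := geometric_hahn_banach_point_closed hC hcl hm
  obtain ⟨u, hu⟩ := exists_pairing_eq f.toLinearMap
  obtain ⟨x, hx, hxm⟩ := h u
  have := hfC x hx
  rw [← hu, ← hu] at hxm
  exact absurd hxm (not_le.2 (hfm.trans this))

lemma polarDualV_polarDualV {d k : ℕ} {C : Set (Vdk d k)} (hC : Convex ℝ C)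
    (hcl : IsClosed C) (h0 : 0 ∈ C) : polarDualV (polarDualV C) = C := by
  refine Subset.antisymm (fun m hm => ?_) fun x hx y hy => ?_
  · by_contra hmC
    obtain ⟨f, a, hfm, hfC⟩ := geometric_hahn_banach_point_closed hC hcl hmC
    obtain ⟨u, hu⟩ := exists_pairingV_eq f.toLinearMap
    have hfu : ∀ x, f x = pairingV x u := hu
    have ha : a < 0 := by simpa using hfC 0 h0
    have hpos : 0 < (-a)⁻¹ := inv_pos.2 (neg_pos.2 ha)
    have hmem : (-a)⁻¹ • u ∈ polarDualV C := fun x hx => by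
      rw [pairingV_comm, pairingV_smul_left, pairingV_comm, ← hfu]
      have := mul_lt_mul_of_pos_left (hfC x hx) hpos
      have h1 : (-a)⁻¹ * a = -1 := by rw [inv_neg, neg_mul, inv_mul_cancel₀ ha.ne]
      linarith
    have h2 := hm _ hmem
    rw [pairingV_smul_left, pairingV_comm, ← hfu] at h2
    have := mul_lt_mul_of_pos_left hfm hpos
    have h1 : (-a)⁻¹ * a = -1 := by rw [inv_neg, neg_mul, inv_mul_cancel₀ ha.ne]
    linarith
  · rw [pairingV_comm]; exact hy x hx

lemma polarDualV_convexHull {d k : ℕ} (S : Set (Vdk d k)) :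
    polarDualV (convexHull ℝ S) = polarDualV S :=
  Subset.antisymm (fun _ hy x hx => hy x (subset_convexHull ℝ S hx))
    fun _ hy _ hx => le_pairingV_convexHull hy hx

lemma zero_mem_interior_polarDualV {d k : ℕ} {S : Set (Vdk d k)} (hS : S.Finite) :
    (0 : Vdk d k) ∈ interior (polarDualV S) := by
  refine mem_interior.2 ⟨⋂ x ∈ S, {y | -1 < pairingV x y}, fun y hy x hx => ?_, ?_, ?_⟩
  · exact (mem_iInter₂.1 hy x hx).le
  · exact hS.isOpen_biInter fun x _ => isOpen_lt continuous_const (continuous_pairingV_right x)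
  · refine mem_iInter₂.2 fun x _ => ?_
    simp [pairingV_comm x, pairingV_zero_left]

/-! ### Lattice points and lattice polytopes -/

lemma IsLatticePt.add {n : ℕ} {x y : Fin n → ℝ} (hx : IsLatticePt x) (hy : IsLatticePt y) :
    IsLatticePt (x + y) := fun i => by
  obtain ⟨a, ha⟩ := hx i
  obtain ⟨b, hb⟩ := hy i
  exact ⟨a + b, by simp [ha, hb]⟩

lemma IsLatticePt.neg {n : ℕ} {x : Fin n → ℝ} (hx : IsLatticePt x) : IsLatticePt (-x) := fun i => by
  obtain ⟨a, ha⟩ := hx i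
  exact ⟨-a, by simp [ha]⟩

lemma isLatticePt_zero {n : ℕ} : IsLatticePt (0 : Fin n → ℝ) := fun _ => ⟨0, by simp⟩

lemma isLatticePt_single {n : ℕ} (i : Fin n) : IsLatticePt (Pi.single i (1 : ℝ)) := fun j => by
  by_cases h : j = i
  · subst h; exact ⟨1, by simp⟩
  · exact ⟨0, by simp [h]⟩

lemma isLatticePt_evec {k : ℕ} (i : Fin (k + 1)) : IsLatticePt (evec i) := by
  refine Fin.cases (fun _ => ⟨-1, by simp [evec]⟩) (fun i => ?_) i
  exact isLatticePt_single i

lemma IsLatticePt.exists_int_pairing {n : ℕ} {x y : Fin n → ℝ} (hx : IsLatticePt x)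
    (hy : IsLatticePt y) : ∃ z : ℤ, pairing x y = z := by
  choose a ha using hx
  choose b hb using hy
  exact ⟨∑ i, a i * b i, by simp [pairing, ha, hb]⟩

lemma IsLatticePtV.add {d k : ℕ} {x y : Vdk d k} (hx : IsLatticePtV x) (hy : IsLatticePtV y) :
    IsLatticePtV (x + y) := ⟨hx.1.add hy.1, hx.2.add hy.2⟩

lemma IsLatticePtV.neg {d k : ℕ} {x : Vdk d k} (hx : IsLatticePtV x) : IsLatticePtV (-x) :=
  ⟨hx.1.neg, hx.2.neg⟩

lemma isLatticePtV_zero {d k : ℕ} : IsLatticePtV (0 : Vdk d k) :=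
  ⟨isLatticePt_zero, isLatticePt_zero⟩

lemma IsLatticePolytopeV.add {d k : ℕ} {P P' : Set (Vdk d k)} (hP : IsLatticePolytopeV P)
    (hP' : IsLatticePolytopeV P') : IsLatticePolytopeV (P + P') := by
  obtain ⟨S, hS, hl, rfl⟩ := hP
  obtain ⟨S', hS', hl', rfl⟩ := hP'
  refine ⟨S + S', hS.add hS', ?_, (convexHull_add S S').symm⟩
  rintro _ ⟨x, hx, y, hy, rfl⟩
  exact (hl x hx).add (hl' y hy)

lemma isLatticePolytopeV_singleton {d k : ℕ} {x : Vdk d k} (hx : IsLatticePtV x) :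
    IsLatticePolytopeV {x} :=
  ⟨{x}, finite_singleton x, by simpa using hx, by simp⟩

lemma IsLatticePolytopeV.sum {d k : ℕ} {ι : Type*} [Fintype ι] {P : ι → Set (Vdk d k)}
    (hP : ∀ i, IsLatticePolytopeV (P i)) : IsLatticePolytopeV (∑ i, P i) :=
  Finset.sum_induction P IsLatticePolytopeV (fun _ _ h h' => h.add h')
    (isLatticePolytopeV_singleton isLatticePtV_zero) fun i _ => hP i

lemma IsLatticePolytopeV.convexHull_iUnion {d k : ℕ} {ι : Type*} [Finite ι]
    {P : ι → Set (Vdk d k)} (hP : ∀ i, IsLatticePolytopeV (P i)) :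
    IsLatticePolytopeV (convexHull ℝ (⋃ i, P i)) := by
  choose S hS hl hPS using hP
  refine ⟨⋃ i, S i, finite_iUnion hS, fun x hx => ?_, ?_⟩
  · obtain ⟨i, hi⟩ := mem_iUnion.1 hx
    exact hl i x hi
  · refine Subset.antisymm (convexHull_min (iUnion_subset fun i => ?_) (convex_convexHull ℝ _))
      (convexHull_mono (iUnion_mono fun i => ?_))
    · rw [hPS]
      exact convexHull_mono (subset_iUnion S i)
    · rw [hPS]
      exact subset_convexHull ℝ _

lemma IsLatticePolytope.isCompact {n : ℕ} {P : Set (Fin n → ℝ)} (hP : IsLatticePolytope P) :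
    IsCompact P := by
  obtain ⟨S, hS, -, rfl⟩ := hP
  exact hS.isCompact_convexHull ℝ

lemma IsLatticePolytope.convex {n : ℕ} {P : Set (Fin n → ℝ)} (hP : IsLatticePolytope P) :
    Convex ℝ P := by
  obtain ⟨S, -, -, rfl⟩ := hP
  exact convex_convexHull ℝ S

lemma IsLatticePolytopeV.isClosed {d k : ℕ} {P : Set (Vdk d k)} (hP : IsLatticePolytopeV P) :
    IsClosed P := by
  obtain ⟨S, hS, -, rfl⟩ := hP
  exact (hS.isCompact_convexHull ℝ).isClosed

lemma IsLatticePolytopeV.zero_mem_interior_polarDualV {d k : ℕ} {P : Set (Vdk d k)}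
    (hP : IsLatticePolytopeV P) : (0 : Vdk d k) ∈ interior (polarDualV P) := by
  obtain ⟨S, hS, -, rfl⟩ := hP
  rw [polarDualV_convexHull]
  exact _root_.zero_mem_interior_polarDualV hS

/-! ### Support functions -/

lemma minPair_le {n : ℕ} {P : Set (Fin n → ℝ)} (hP : IsCompact P) {x : Fin n → ℝ} (hx : x ∈ P)
    (u : Fin n → ℝ) : minPair P u ≤ pairing x u :=
  csInf_le (hP.image (continuous_pairing_left u)).bddBelow (mem_image_of_mem _ hx)

lemma exists_pairing_eq_minPair {n : ℕ} {P : Set (Fin n → ℝ)} (hP : IsCompact P)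
    (hne : P.Nonempty) (u : Fin n → ℝ) : ∃ x ∈ P, pairing x u = minPair P u :=
  (hP.image (continuous_pairing_left u)).sInf_mem (hne.image _)

lemma minPair_smul {n : ℕ} {P : Set (Fin n → ℝ)} (hP : IsCompact P) (hne : P.Nonempty) {c : ℝ}
    (hc : 0 ≤ c) (u : Fin n → ℝ) : minPair P (c • u) = c * minPair P u := by
  obtain ⟨x, hx, hxu⟩ := exists_pairing_eq_minPair hP hne u
  obtain ⟨y, hy, hyu⟩ := exists_pairing_eq_minPair hP hne (c • u)
  apply le_antisymm
  · rw [← hxu, ← pairing_smul_right]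
    exact minPair_le hP hx _
  · rw [← hyu, pairing_smul_right]
    exact mul_le_mul_of_nonneg_left (minPair_le hP hy u) hc

lemma IsLatticePolytope.exists_int_minPair {n : ℕ} {P : Set (Fin n → ℝ)}
    (hP : IsLatticePolytope P) (hne : P.Nonempty) {u : Fin n → ℝ} (hu : IsLatticePt u) :
    ∃ z : ℤ, minPair P u = z := by
  have hc := hP.isCompact
  obtain ⟨S, hS, hl, rfl⟩ := hP
  have hSne : S.Nonempty := convexHull_nonempty_iff.1 hne
  obtain ⟨s, hs, hmin⟩ := exists_min_image S (fun x => pairing x u) hS hSne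
  obtain ⟨x, hx, hxu⟩ := exists_pairing_eq_minPair hc hne u
  obtain ⟨z, hz⟩ := (hl s hs).exists_int_pairing hu
  refine ⟨z, ?_⟩
  rw [← hz]
  apply le_antisymm (minPair_le hc (subset_convexHull ℝ S hs) u)
  rw [← hxu]
  exact le_pairing_convexHull hmin hx

lemma nonempty_of_zero_mem_interior_sum {n : ℕ} {ι : Type*} [Fintype ι]
    {Δ : ι → Set (Fin n → ℝ)} (h0 : (0 : Fin n → ℝ) ∈ interior (∑ i, Δ i)) (i : ι) :
    (Δ i).Nonempty := by
  obtain ⟨g, hg, -⟩ := (mem_fintype_sum Δ 0).1 (interior_subset h0)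
  exact ⟨g i, hg i⟩

lemma mem_polarDual_sum_iff {n : ℕ} {ι : Type*} [Fintype ι] {Δ : ι → Set (Fin n → ℝ)}
    (hc : ∀ i, IsCompact (Δ i)) (hne : ∀ i, (Δ i).Nonempty) (u : Fin n → ℝ) :
    u ∈ polarDual (∑ i, Δ i) ↔ -1 ≤ ∑ i, minPair (Δ i) u := by
  constructor
  · intro h
    choose g hg hgu using fun i => exists_pairing_eq_minPair (hc i) (hne i) u
    have := h (∑ i, g i) ((mem_fintype_sum Δ _).2 ⟨g, hg, rfl⟩)
    rw [pairing_sum_left] at this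
    simpa only [hgu] using this
  · intro h x hx
    obtain ⟨g, hg, rfl⟩ := (mem_fintype_sum Δ x).1 hx
    rw [pairing_sum_left]
    exact h.trans (Finset.sum_le_sum fun i _ => minPair_le (hc i) (hg i) u)

lemma sum_minPair_neg {n : ℕ} {ι : Type*} [Fintype ι] {Δ : ι → Set (Fin n → ℝ)}
    (hc : ∀ i, IsCompact (Δ i)) (h0 : (0 : Fin n → ℝ) ∈ interior (∑ i, Δ i))
    {u : Fin n → ℝ} (hu : u ≠ 0) : ∑ i, minPair (Δ i) u < 0 := by
  have hcont : Continuous fun t : ℝ => -(t • u) := by fun_prop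
  have hnhds : ∀ᶠ t : ℝ in nhds 0, -(t • u) ∈ ∑ i, Δ i := by
    apply hcont.continuousAt.eventually_mem
    simpa using mem_interior_iff_mem_nhds.1 h0
  obtain ⟨t, ht, htpos⟩ :=
    ((hnhds.filter_mono nhdsWithin_le_nhds).and (self_mem_nhdsWithin (s := Ioi (0 : ℝ)))).exists
  obtain ⟨g, hg, hgt⟩ := (mem_fintype_sum Δ _).1 ht
  have hle : ∑ i, minPair (Δ i) u ≤ pairing (-(t • u)) u := by
    rw [← hgt, pairing_sum_left]
    exact Finset.sum_le_sum fun i _ => minPair_le (hc i) (hg i) u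
  rw [← neg_smul, pairing_smul_left] at hle
  have hpos : 0 < pairing u u := by
    refine lt_of_le_of_ne (Finset.sum_nonneg fun i _ => mul_self_nonneg (u i)) fun h => hu ?_
    exact dotProduct_self_eq_zero.1 h.symm
  have : 0 < t * pairing u u := mul_pos htpos hpos
  linarith

lemma mem_sum_smul_of_le_pairing {n : ℕ} {ι : Type*} [Fintype ι] {Δ : ι → Set (Fin n → ℝ)}
    (hlat : ∀ i, IsLatticePolytope (Δ i)) (h0 : (0 : Fin n → ℝ) ∈ interior (∑ i, Δ i))
    (τ : ι → ℝ) {m : Fin n → ℝ}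
    (h : ∀ u, ∑ i, minPair (Δ i) u = -1 → ∑ i, τ i * minPair (Δ i) u ≤ pairing m u) :
    m ∈ ∑ i, τ i • Δ i := by
  have hc := fun i => (hlat i).isCompact
  have hne := nonempty_of_zero_mem_interior_sum h0
  have hcompact : IsCompact (∑ i, τ i • Δ i) :=
    Finset.sum_induction _ IsCompact (fun _ _ h h' => h.add h') isCompact_singleton
      fun i _ => (hc i).smul (τ i)
  have hconvex : Convex ℝ (∑ i, τ i • Δ i) :=
    Finset.sum_induction _ (Convex ℝ) (fun _ _ h h' => h.add h') (convex_singleton 0)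
      fun i _ => (hlat i).convex.smul (τ i)
  refine mem_of_forall_exists_pairing_le hconvex hcompact.isClosed fun u => ?_
  choose g hg hgu using fun i => exists_pairing_eq_minPair (hc i) (hne i) u
  refine ⟨∑ i, τ i • g i,
    (mem_fintype_sum _ _).2 ⟨_, fun i => smul_mem_smul_set (hg i), rfl⟩, ?_⟩
  simp only [pairing_sum_left, pairing_smul_left, hgu]
  rcases eq_or_ne u 0 with rfl | hu
  · simp only [pairing_zero_right] at hgu
    simp [← hgu, pairing_zero_right]
  · have hneg := sum_minPair_neg hc h0 hu
    set c := -∑ i, minPair (Δ i) u with hcdef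
    have hcpos : 0 < c := neg_pos.2 hneg
    have hsm := fun i => minPair_smul (hc i) (hne i) (inv_pos.2 hcpos).le u
    have h1 := h (c⁻¹ • u) (by
      simp only [hsm, ← Finset.mul_sum]
      rw [show ∑ i, minPair (Δ i) u = -c by simp [hcdef], mul_neg, inv_mul_cancel₀ hcpos.ne'])
    simp only [hsm, pairing_smul_right, mul_left_comm _ c⁻¹, ← Finset.mul_sum] at h1
    exact le_of_mul_le_mul_left h1 (inv_pos.2 hcpos)

/-! ### The polytopes `∇̂ᵢ` and `Δ̃ᵢ` -/

/-- The vectors `e₀* = 0, e₁*, …, e_k*` by which `∇̂₀` is translated. -/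
def dualShift {d k : ℕ} : Fin (k + 1) → Vdk d k :=
  Fin.cases 0 fun i => (0, Pi.single i 1)

/-- The point `u − Σᵢ₌₁ᵏ min⟨Δᵢ,u⟩eᵢ*`. -/
def liftDual {d k : ℕ} (Δ : Fin (k + 1) → Set (Fin d → ℝ)) (u : Fin d → ℝ) : Vdk d k :=
  (u, fun i => -(minPair (Δ i.succ) u))

/-- The points `y` with `⟨x + eᵢ, y⟩ ≥ -bᵢ` for all `x ∈ Δᵢ` and all `i`. -/
def cayleyDual {d k : ℕ} (Δ : Fin (k + 1) → Set (Fin d → ℝ)) (b : Fin (k + 1) → ℝ) :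
    Set (Vdk d k) :=
  {y | ∀ i, -b i ≤ minPair (Δ i) y.1 + pairing (evec i) y.2}

lemma pairing_evec_zero {k : ℕ} (t : Fin k → ℝ) : pairing (evec 0) t = -∑ i, t i := by
  simp [pairing, evec]

lemma pairing_evec_succ {k : ℕ} (i : Fin k) (t : Fin k → ℝ) : pairing (evec i.succ) t = t i := by
  simp [pairing_eq_dotProduct, evec]

lemma pairing_evec_dualShift {d k : ℕ} (i j : Fin (k + 1)) :
    pairing (evec i) (dualShift j : Vdk d k).2 =
      (if j = i then (1 : ℝ) else 0) - (if i = 0 then (1 : ℝ) else 0) := by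
  refine Fin.cases ?_ (fun j => ?_) j
  · by_cases h : i = 0
    · simp [dualShift, pairing_zero_right, h]
    · simp [dualShift, pairing_zero_right, h, Ne.symm h]
  · refine Fin.cases ?_ (fun i => ?_) i
    · simp [pairing_evec_zero, dualShift]
    · simp [pairing_evec_succ, dualShift, Pi.single_apply, eq_comm]

lemma dualShift_fst {d k : ℕ} (j : Fin (k + 1)) : (dualShift j : Vdk d k).1 = 0 := by
  refine Fin.cases rfl (fun j => rfl) j

lemma isLatticePtV_dualShift {d k : ℕ} (j : Fin (k + 1)) :
    IsLatticePtV (dualShift j : Vdk d k) := by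
  refine Fin.cases isLatticePtV_zero (fun j => ⟨isLatticePt_zero, isLatticePt_single j⟩) j

lemma mem_cayleyDual_iff {d k : ℕ} {Δ : Fin (k + 1) → Set (Fin d → ℝ)}
    (hc : ∀ i, IsCompact (Δ i)) (hne : ∀ i, (Δ i).Nonempty) {b : Fin (k + 1) → ℝ} {y : Vdk d k} :
    y ∈ cayleyDual Δ b ↔ ∀ i, ∀ x ∈ Δ i, -b i ≤ pairingV (x, evec i) y := by
  refine forall_congr' fun i => ⟨fun h x hx => ?_, fun h => ?_⟩
  · have := minPair_le (hc i) hx y.1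
    simp only [pairingV]
    linarith
  · obtain ⟨x, hx, hxy⟩ := exists_pairing_eq_minPair (hc i) (hne i) y.1
    rw [← hxy]
    exact h x hx

lemma convex_cayleyDual {d k : ℕ} {Δ : Fin (k + 1) → Set (Fin d → ℝ)}
    (hc : ∀ i, IsCompact (Δ i)) (hne : ∀ i, (Δ i).Nonempty) (b : Fin (k + 1) → ℝ) :
    Convex ℝ (cayleyDual Δ b) := by
  intro y hy z hz α β hα hβ hαβ
  rw [mem_cayleyDual_iff hc hne] at hy hz ⊢
  intro i x hx
  rw [pairingV_comm, pairingV_add_left, pairingV_smul_left, pairingV_smul_left,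
    pairingV_comm y, pairingV_comm z]
  have h1 := mul_le_mul_of_nonneg_left (hy i x hx) hα
  have h2 := mul_le_mul_of_nonneg_left (hz i x hx) hβ
  have h3 : α * -b i + β * -b i = -b i := by rw [← add_mul, hαβ, one_mul]
  linarith

lemma minPair_zero {n : ℕ} {P : Set (Fin n → ℝ)} (hne : P.Nonempty) : minPair P 0 = 0 := by
  simp [minPair, pairing_zero_right, hne.image_const]

lemma sub_dualShift_mem_cayleyDual {d k : ℕ} {Δ : Fin (k + 1) → Set (Fin d → ℝ)} {y : Vdk d k}
    (j : Fin (k + 1)) :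
    y - dualShift j ∈ cayleyDual Δ (fun i => if j = i then 1 else 0) ↔
      y ∈ cayleyDual Δ (fun i => if 0 = i then 1 else 0) := by
  refine forall_congr' fun i => ?_
  have h : pairing (evec i) (y - dualShift j).2 =
      pairing (evec i) y.2 - pairing (evec i) (dualShift j : Vdk d k).2 := by
    rw [eq_sub_iff_add_eq, ← pairing_add_right, ← Prod.snd_add, sub_add_cancel]
  rw [h, pairing_evec_dualShift, Prod.fst_sub, dualShift_fst, sub_zero]
  simp only [eq_comm (a := (0 : Fin (k + 1)))]
  constructor <;> intro h <;> linarith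

lemma convexHull_liftDual_eq_cayleyDual {d k : ℕ} {Δ : Fin (k + 1) → Set (Fin d → ℝ)}
    (hc : ∀ i, IsCompact (Δ i)) (h0 : (0 : Fin d → ℝ) ∈ interior (∑ i, Δ i)) :
    convexHull ℝ (liftDual Δ '' polarDual (∑ i, Δ i) ∪ range dualShift) =
      cayleyDual Δ fun i => if 0 = i then 1 else 0 := by
  have hne := nonempty_of_zero_mem_interior_sum h0
  apply Subset.antisymm
  · refine convexHull_min (union_subset ?_ ?_) (convex_cayleyDual hc hne _)
    · rintro _ ⟨u, hu, rfl⟩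
      rw [mem_polarDual_sum_iff hc hne, Fin.sum_univ_succ] at hu
      refine Fin.cases ?_ fun i => ?_
      · simp only [liftDual, pairing_evec_zero, Finset.sum_neg_distrib, neg_neg, if_true]
        exact hu
      · simp [liftDual, pairing_evec_succ, (Fin.succ_ne_zero i).symm]
    · rintro _ ⟨j, rfl⟩ i
      rw [pairing_evec_dualShift, dualShift_fst, minPair_zero (hne i)]
      simp only [eq_comm (a := (0 : Fin (k + 1)))]
      split_ifs <;> norm_num
  · rintro ⟨u, t⟩ hut
    set C := convexHull ℝ (liftDual Δ '' polarDual (∑ i, Δ i) ∪ range dualShift)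
    have hconv : Convex ℝ C := convex_convexHull ℝ _
    have hsub : _ ⊆ C := subset_convexHull ℝ _
    set c := -∑ i, minPair (Δ i) u with hcdef
    set s : Fin k → ℝ := fun i => t i + minPair (Δ i.succ) u with hs
    have hs0 : ∀ i, 0 ≤ s i := fun i => by
      have := hut i.succ
      simp only [(Fin.succ_ne_zero i).symm, if_false, pairing_evec_succ] at this
      simp only [hs]; linarith
    have hcs : c + ∑ i, s i ≤ 1 := by
      have := hut 0
      simp only [if_true, pairing_evec_zero] at this
      simp only [hcdef, hs, Finset.sum_add_distrib, Fin.sum_univ_succ]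
      linarith
    have hc0 : 0 ≤ c := by
      rcases eq_or_ne u 0 with rfl | hu
      · simp [hcdef, minPair_zero (hne _)]
      · exact (neg_pos.2 (sum_minPair_neg hc h0 hu)).le
    have hz : (0 : Vdk d k) ∈ C := hsub (Or.inr ⟨0, rfl⟩)
    obtain ⟨v, hv, hcv⟩ : ∃ v ∈ C, c • v = liftDual Δ u := by
      rcases hc0.eq_or_lt' with hc0 | hcpos
      · refine ⟨0, hz, ?_⟩
        obtain rfl : u = 0 := by
          by_contra hu
          have := sum_minPair_neg hc h0 hu
          linarith
        ext i <;> simp [liftDual, minPair_zero (hne _)]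
      · have hsm := fun i => minPair_smul (hc i) (hne i) (inv_pos.2 hcpos).le u
        refine ⟨liftDual Δ (c⁻¹ • u), hsub (Or.inl ⟨_, ?_, rfl⟩), ?_⟩
        · rw [mem_polarDual_sum_iff hc hne]
          simp only [hsm, ← Finset.mul_sum]
          rw [show ∑ i, minPair (Δ i) u = -c by simp [hcdef], mul_neg,
            inv_mul_cancel₀ hcpos.ne']
        · ext i
          · simp [liftDual, hcpos.ne']
          · simp [liftDual, hsm, hcpos.ne']
    have hsum : ((u, t) : Vdk d k) =
        (1 - (c + ∑ i, s i)) • (0 : Vdk d k) + (c • v + ∑ i, s i • dualShift i.succ) := by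
      rw [hcv, smul_zero, zero_add]
      ext i
      · simp [liftDual, Prod.fst_sum, dualShift]
      · simp [liftDual, Prod.snd_sum, dualShift, hs, Pi.single_apply]
    have hmem := hconv.sum_mem (t := (Finset.univ : Finset (Option (Option (Fin k)))))
      (w := fun o => o.elim (1 - (c + ∑ i, s i)) fun o => o.elim c s)
      (z := fun o => o.elim 0 fun o => o.elim v fun i => dualShift i.succ) ?_ ?_ ?_
    · rw [hsum]
      simpa [Fintype.sum_option] using hmem
    · rintro (_ | _ | i) -
      · simpa using hcs
      · exact hc0
      · exact hs0 i
    · simp [Fintype.sum_option]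
    · rintro (_ | _ | i) -
      · exact hz
      · exact hv
      · exact hsub (Or.inr ⟨i.succ, rfl⟩)

lemma isLatticePtV_liftDual {d k : ℕ} {Δ : Fin (k + 1) → Set (Fin d → ℝ)}
    (hlat : ∀ i, IsLatticePolytope (Δ i)) (hne : ∀ i, (Δ i).Nonempty) {u : Fin d → ℝ}
    (hu : IsLatticePt u) : IsLatticePtV (liftDual Δ u) := by
  refine ⟨hu, fun i => ?_⟩
  obtain ⟨z, hz⟩ := (hlat i.succ).exists_int_minPair (hne i.succ) hu
  exact ⟨-z, by simp [liftDual, hz]⟩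

lemma isLatticePolytopeV_convexHull_liftDual {d k : ℕ} {Δ : Fin (k + 1) → Set (Fin d → ℝ)}
    (hlat : ∀ i, IsLatticePolytope (Δ i)) (hrefl : IsReflexive (∑ i, Δ i)) :
    IsLatticePolytopeV
      (convexHull ℝ (liftDual Δ '' polarDual (∑ i, Δ i) ∪ range dualShift)) := by
  obtain ⟨-, h0, S, hS, hl, hpol⟩ := hrefl
  have hc := fun i => (hlat i).isCompact
  have hne := nonempty_of_zero_mem_interior_sum h0
  refine ⟨liftDual Δ '' S ∪ range dualShift, (hS.image _).union (finite_range _), ?_, ?_⟩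
  · rintro _ (⟨u, hu, rfl⟩ | ⟨j, rfl⟩)
    · exact isLatticePtV_liftDual hlat hne (hl u hu)
    · exact isLatticePtV_dualShift j
  set C := convexHull ℝ (liftDual Δ '' S ∪ range dualShift)
  have hconv : Convex ℝ C := convex_convexHull ℝ _
  have hsub : _ ⊆ C := subset_convexHull ℝ _
  have hz : (0 : Vdk d k) ∈ C := hsub (Or.inr ⟨0, rfl⟩)
  refine Subset.antisymm (convexHull_min (union_subset ?_ ?_) hconv) (convexHull_mono ?_)
  · rintro _ ⟨u, hu, rfl⟩
    rcases eq_or_ne u 0 with rfl | hu0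
    · convert hz using 1
      ext i <;> simp [liftDual, minPair_zero (hne _)]
    have hneg := sum_minPair_neg hc h0 hu0
    rw [mem_polarDual_sum_iff hc hne] at hu
    set c := -∑ i, minPair (Δ i) u with hcdef
    have hcpos : 0 < c := neg_pos.2 hneg
    have hsm := fun i => minPair_smul (hc i) (hne i) (inv_pos.2 hcpos).le u
    have hsum : ∑ i, minPair (Δ i) (c⁻¹ • u) = -1 := by
      simp only [hsm, ← Finset.mul_sum]
      rw [show ∑ i, minPair (Δ i) u = -c by simp [hcdef], mul_neg, inv_mul_cancel₀ hcpos.ne']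
    have hmem : c⁻¹ • u ∈ convexHull ℝ (hS.toFinset : Set (Fin d → ℝ)) := by
      rw [hS.coe_toFinset, ← hpol, mem_polarDual_sum_iff hc hne, hsum]
    obtain ⟨w, hw0, hw1, hwu⟩ := Finset.mem_convexHull'.1 hmem
    have hle : ∀ i, ∑ s ∈ hS.toFinset, w s * minPair (Δ i) s ≤ minPair (Δ i) (c⁻¹ • u) := by
      intro i
      obtain ⟨x, hx, hxu⟩ := exists_pairing_eq_minPair (hc i) (hne i) (c⁻¹ • u)
      rw [← hxu, ← hwu, pairing_sum_right]
      refine Finset.sum_le_sum fun s hs => ?_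
      rw [pairing_smul_right]
      exact mul_le_mul_of_nonneg_left (minPair_le (hc i) hx s) (hw0 s hs)
    have hge : -1 ≤ ∑ i, ∑ s ∈ hS.toFinset, w s * minPair (Δ i) s := by
      rw [Finset.sum_comm, ← hw1, ← Finset.sum_neg_distrib]
      refine Finset.sum_le_sum fun s hs => ?_
      have hs' : -1 ≤ ∑ i, minPair (Δ i) s := by
        rw [← mem_polarDual_sum_iff hc hne, hpol]
        exact subset_convexHull ℝ S (hS.mem_toFinset.1 hs)
      rw [← Finset.mul_sum]
      have := mul_le_mul_of_nonneg_left hs' (hw0 s hs)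
      linarith
    have heq : ∀ i, ∑ s ∈ hS.toFinset, w s * minPair (Δ i) s = minPair (Δ i) (c⁻¹ • u) := by
      have := (Finset.sum_eq_sum_iff_of_le fun i _ => hle i).1
        (le_antisymm (Finset.sum_le_sum fun i _ => hle i) (hsum ▸ hge))
      exact fun i => this i (Finset.mem_univ i)
    have hlift : ∑ s ∈ hS.toFinset, w s • liftDual Δ s = liftDual Δ (c⁻¹ • u) := by
      refine Prod.ext ?_ (funext fun i => ?_)
      · simp [Prod.fst_sum, liftDual, hwu]
      · simp [Prod.snd_sum, liftDual, ← heq]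
    have hmemC : liftDual Δ (c⁻¹ • u) ∈ C := by
      rw [← hlift]
      exact hconv.sum_mem hw0 hw1 fun s hs => hsub (Or.inl ⟨s, hS.mem_toFinset.1 hs, rfl⟩)
    have hu' : liftDual Δ u = (c • liftDual Δ (c⁻¹ • u) : Vdk d k) := by
      ext i
      · simp [liftDual, hcpos.ne']
      · simp [liftDual, hsm, hcpos.ne']
    rw [hu']
    exact hconv.smul_mem_of_zero_mem hz hmemC ⟨hcpos.le, by linarith⟩
  · exact fun x hx => hsub (Or.inr hx)
  · refine union_subset_union_left _ (image_mono ?_)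
    rw [hpol]
    exact subset_convexHull ℝ S

lemma exists_weights_of_le_pairingV {d k : ℕ} {Δ : Fin (k + 1) → Set (Fin d → ℝ)}
    (hlat : ∀ i, IsLatticePolytope (Δ i)) (h0 : (0 : Fin d → ℝ) ∈ interior (∑ i, Δ i))
    {b : Fin (k + 1) → ℝ} {y : Vdk d k}
    (hy : ∀ i, ∀ x ∈ cayleyDual Δ fun l => if i = l then 1 else 0, -b i ≤ pairingV x y) :
    ∃ τ : Fin (k + 1) → ℝ, (∀ i, 0 ≤ τ i ∧ τ i ≤ b i) ∧
      ∃ x : Fin (k + 1) → Fin d → ℝ, (∀ i, x i ∈ Δ i) ∧ y = ∑ i, τ i • (x i, evec i) := by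
  have hc := fun i => (hlat i).isCompact
  have hne := nonempty_of_zero_mem_interior_sum h0
  set s : Fin (k + 1) → ℝ := fun i => pairingV (dualShift i) y with hs
  have hs_zero : s 0 = 0 := pairingV_zero_left y
  have hs_succ : ∀ i : Fin k, s i.succ = y.2 i := fun i => by
    simp [hs, dualShift, pairingV, pairing_eq_dotProduct]
  have hgen : ∀ i, ∀ z ∈ liftDual Δ '' polarDual (∑ i, Δ i) ∪ range dualShift,
      s i - b i ≤ pairingV z y := fun i z hz => by
    have hz' := subset_convexHull ℝ _ hz
    rw [convexHull_liftDual_eq_cayleyDual hc h0, ← sub_dualShift_mem_cayleyDual i] at hz'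
    have := hy i _ hz'
    rw [pairingV_sub_left] at this
    simp only [hs]
    linarith
  obtain ⟨i₀, -, hi₀⟩ := Finset.exists_min_image Finset.univ (fun i => b i - s i)
    Finset.univ_nonempty
  set τ : Fin (k + 1) → ℝ := fun i => s i + (b i₀ - s i₀) with hτ
  have hmem : y.1 ∈ ∑ i, τ i • Δ i := by
    refine mem_sum_smul_of_le_pairing hlat h0 τ fun u hu => ?_
    have := hgen i₀ _ (Or.inl ⟨u, (mem_polarDual_sum_iff hc hne u).2 hu.ge, rfl⟩)
    have hlift : pairingV (liftDual Δ u) y =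
        pairing y.1 u - ∑ i : Fin k, s i.succ * minPair (Δ i.succ) u := by
      simp only [pairingV, liftDual, hs_succ, pairing_comm u, sub_eq_add_neg,
        ← Finset.sum_neg_distrib]
      simp only [pairing, add_right_inj]
      exact Finset.sum_congr rfl fun i _ => by ring
    have hsum : ∑ i, τ i * minPair (Δ i) u =
        ∑ i : Fin k, s i.succ * minPair (Δ i.succ) u - (b i₀ - s i₀) := by
      simp only [hτ, add_mul, Finset.sum_add_distrib, ← Finset.mul_sum, hu]
      rw [Fin.sum_univ_succ, hs_zero]
      ring
    linarith
  obtain ⟨g, hg, hgy⟩ := (mem_fintype_sum _ _).1 hmem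
  choose x hx hxg using fun i => mem_smul_set.1 (hg i)
  refine ⟨τ, fun i => ⟨?_, ?_⟩, x, hx, Prod.ext ?_ (funext fun l => ?_)⟩
  · have := hgen i₀ _ (Or.inr ⟨i, rfl⟩)
    simp only [hτ, hs] at this ⊢
    linarith
  · have := hi₀ i (Finset.mem_univ i)
    simp only [hτ]
    linarith
  · simp [Prod.fst_sum, hxg, hgy]
  · simp [Prod.snd_sum, Fin.sum_univ_succ, evec, hτ, hs_zero, hs_succ, Pi.single_apply]
    ring

lemma smul_mem_convexHull_union_zero {E : Type*} [AddCommGroup E] [Module ℝ E] {S : Set E} {x : E}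
    (hx : x ∈ S) {τ : ℝ} (h0 : 0 ≤ τ) (h1 : τ ≤ 1) : τ • x ∈ convexHull ℝ (S ∪ {0}) :=
  (convex_convexHull ℝ _).smul_mem_of_zero_mem
    (subset_convexHull ℝ (S ∪ {0}) (mem_union_right S (mem_singleton 0)))
    (subset_convexHull ℝ _ (mem_union_left {0} hx)) ⟨h0, h1⟩

lemma neg_le_pairingV_of_mem_cayleyDual {d k : ℕ} {Δ : Fin (k + 1) → Set (Fin d → ℝ)}
    (hc : ∀ i, IsCompact (Δ i)) (hne : ∀ i, (Δ i).Nonempty) {b : Fin (k + 1) → ℝ} {y : Vdk d k}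
    (hy : y ∈ cayleyDual Δ b) {i : Fin (k + 1)} (hb : 0 ≤ b i) {x : Vdk d k}
    (hx : x ∈ convexHull ℝ ((fun x => ((x, evec i) : Vdk d k)) '' Δ i ∪ {0})) :
    -b i ≤ pairingV x y := by
  refine le_pairingV_convexHull ?_ hx
  rintro _ (⟨x, hx, rfl⟩ | rfl)
  · exact (mem_cayleyDual_iff hc hne).1 hy i x hx
  · simpa [pairingV_zero_left] using hb

lemma cayleyDual_one_eq_polarDualV {d k : ℕ} {Δ : Fin (k + 1) → Set (Fin d → ℝ)}
    (hc : ∀ i, IsCompact (Δ i)) (hne : ∀ i, (Δ i).Nonempty) :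
    polarDualV (convexHull ℝ
      (⋃ i, convexHull ℝ ((fun x => ((x, evec i) : Vdk d k)) '' Δ i ∪ {0}))) =
      cayleyDual Δ 1 := by
  rw [polarDualV_convexHull]
  refine Subset.antisymm (fun y hy => ?_) fun y hy x hx => ?_
  · exact (mem_cayleyDual_iff hc hne).2 fun i x hx =>
      hy _ (mem_iUnion.2 ⟨i, subset_convexHull ℝ _ (Or.inl ⟨x, hx, rfl⟩)⟩)
  · obtain ⟨i, hi⟩ := mem_iUnion.1 hx
    exact neg_le_pairingV_of_mem_cayleyDual hc hne hy (b := 1) zero_le_one hi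

lemma sum_cayleyDual {d k : ℕ} {Δ : Fin (k + 1) → Set (Fin d → ℝ)}
    (hc : ∀ i, IsCompact (Δ i)) (hne : ∀ i, (Δ i).Nonempty) :
    ∑ j, cayleyDual Δ (fun i => if j = i then 1 else 0) = cayleyDual Δ 1 := by
  apply Subset.antisymm
  · intro y hy
    obtain ⟨g, hg, rfl⟩ := (mem_fintype_sum _ _).1 hy
    refine (mem_cayleyDual_iff hc hne).2 fun i x hx => ?_
    rw [pairingV_comm, pairingV_sum_left]
    have := Finset.sum_le_sum fun j (_ : j ∈ Finset.univ) =>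
      (mem_cayleyDual_iff hc hne).1 (hg j) i x hx
    simpa [pairingV_comm] using this
  · intro y hy
    have hk : (0 : ℝ) < k + 1 := by positivity
    set e : Vdk d k := ∑ j, dualShift j with he
    set z : Vdk d k := ((k : ℝ) + 1)⁻¹ • (y + e) with hz
    have hyz : y = ∑ j, (z - dualShift j) := by
      rw [Finset.sum_sub_distrib, ← he, Finset.sum_const, Finset.card_univ, Fintype.card_fin,
        ← Nat.cast_smul_eq_nsmul ℝ, hz, smul_smul, Nat.cast_succ, mul_inv_cancel₀ hk.ne', one_smul,
        add_sub_cancel_right]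
    have hzmem : z ∈ cayleyDual Δ fun i => if 0 = i then 1 else 0 := by
      intro i
      have h1 := hy i
      have hfst : z.1 = ((k : ℝ) + 1)⁻¹ • y.1 := by
        simp [hz, he, Prod.fst_sum, dualShift_fst]
      have hsnd : pairing (evec i) z.2 =
          ((k : ℝ) + 1)⁻¹ * (pairing (evec i) y.2 + (1 - (k + 1) * if i = 0 then 1 else 0)) := by
        rw [hz, Prod.smul_snd, pairing_smul_right, Prod.snd_add, pairing_add_right, he,
          Prod.snd_sum, pairing_sum_right]
        simp only [pairing_evec_dualShift]
        simp
      rw [hfst, hsnd, minPair_smul (hc i) (hne i) (inv_pos.2 hk).le, ← mul_add]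
      simp only [eq_comm (a := (0 : Fin (k + 1))), Pi.one_apply] at h1 ⊢
      rw [inv_mul_eq_div, le_div_iff₀ hk]
      linarith
    rw [hyz]
    exact (mem_fintype_sum _ _).2 ⟨_, fun j => (sub_dualShift_mem_cayleyDual j).2 hzmem, rfl⟩

lemma isLatticePolytopeV_convexHull_union_zero {d k : ℕ} {P : Set (Fin d → ℝ)}
    (hP : IsLatticePolytope P) {e : Fin k → ℝ} (he : IsLatticePt e) :
    IsLatticePolytopeV (convexHull ℝ ((fun x => ((x, e) : Vdk d k)) '' P ∪ {0})) := by
  obtain ⟨S, hS, hl, rfl⟩ := hP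
  refine ⟨(fun x => (x, e)) '' S ∪ {0}, (hS.image _).union (finite_singleton 0), ?_, ?_⟩
  · rintro _ (⟨x, hx, rfl⟩ | rfl)
    · exact ⟨hl x hx, he⟩
    · exact isLatticePtV_zero
  · refine Subset.antisymm (convexHull_min (union_subset ?_ ?_) (convex_convexHull ℝ _))
      (convexHull_mono (union_subset_union_left _ (image_mono (subset_convexHull ℝ S))))
    · have h : (fun x => ((x, e) : Vdk d k)) '' convexHull ℝ S = convexHull ℝ S ×ˢ {e} := by
        rw [prod_singleton]
      rw [h, ← convexHull_singleton (𝕜 := ℝ) e, ← convexHull_prod, prod_singleton]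
      exact convexHull_mono subset_union_left
    · exact fun x hx => subset_convexHull ℝ _ (Or.inr hx)

/-- `∇̂₀ + ⋯ + ∇̂_k` is a reflexive polytope, the decomposition is a
nef-partition whose dual nef-partition is `Δ̃₀ + ⋯ + Δ̃_k`; moreover
`(∇̂₀ ⊎ ⋯ ⊎ ∇̂_k)* = Δ̃₀ + ⋯ + Δ̃_k` and `(Δ̃₀ ⊎ ⋯ ⊎ Δ̃_k)* = ∇̂₀ + ⋯ + ∇̂_k`. -/
theorem hatNabla_nef_partition {d k : ℕ}
    (Δ : Fin (k+1) → Set (Fin d → ℝ))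
    (hlat : ∀ i, IsLatticePolytope (Δ i))
    (hrefl : IsReflexive (∑ i, Δ i))
    -- ∇̂₀ = Conv({u − Σᵢ₌₁ᵏ min⟨Δᵢ,u⟩eᵢ* : u ∈ Δ*} ∪ {e₁*, …, e_k*})
    (Q : Set (Vdk d k))
    (hQ : Q = convexHull ℝ
        ((fun u => ((u, fun i : Fin k => -(minPair (Δ i.succ) u)) : Vdk d k)) ''
            polarDual (∑ i, Δ i) ∪
          ⋃ i : Fin k, {(((0 : Fin d → ℝ), Pi.single i 1) : Vdk d k)}))
    -- ∇̂ᵢ = ∇̂₀ − eᵢ* for i = 1, …, k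
    (Nhat : Fin (k+1) → Set (Vdk d k))
    (hNhat : Nhat = Fin.cases Q
        (fun i => (fun y => y - (((0 : Fin d → ℝ), Pi.single i 1) : Vdk d k)) '' Q))
    -- Δ̃ᵢ = Conv((Δᵢ + eᵢ) ∪ {0}) for i = 0, …, k
    (Δtilde : Fin (k+1) → Set (Vdk d k))
    (hΔtilde : Δtilde = fun i =>
        convexHull ℝ ((fun x => ((x, evec i) : Vdk d k)) '' Δ i ∪ {0})) :
    -- ∇̂₀ + ⋯ + ∇̂_k is a reflexive polytope
    IsReflexiveV (∑ i, Nhat i) ∧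
    -- it is a nef-partition: each ∇̂ᵢ is a lattice polytope containing 0
    (∀ i, IsLatticePolytopeV (Nhat i) ∧ (0 : Vdk d k) ∈ Nhat i) ∧
    -- the dual nef-partition is Δ̃₀ + ⋯ + Δ̃_k
    (∀ j, {y : Vdk d k | ∀ i, ∀ x ∈ Nhat i,
        -(if i = j then (1 : ℝ) else 0) ≤ pairingV x y} = Δtilde j) ∧
    -- (∇̂₀ ⊎ ⋯ ⊎ ∇̂_k)* = Δ̃₀ + ⋯ + Δ̃_k
    polarDualV (convexHull ℝ (⋃ i, Nhat i)) = ∑ i, Δtilde i ∧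
    -- (Δ̃₀ ⊎ ⋯ ⊎ Δ̃_k)* = ∇̂₀ + ⋯ + ∇̂_k
    polarDualV (convexHull ℝ (⋃ i, Δtilde i)) = ∑ i, Nhat i := by
  have h0 := hrefl.2.1
  have hc := fun i => (hlat i).isCompact
  have hne := nonempty_of_zero_mem_interior_sum h0
  have hzero : (0 : Fin d → ℝ) ∈ polarDual (∑ i, Δ i) := fun x _ => by
    simp [pairing_zero_right]
  have hgen : Q = convexHull ℝ (liftDual Δ '' polarDual (∑ i, Δ i) ∪ range dualShift) := by
    rw [hQ]
    congr 1
    ext z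
    simp only [mem_union, mem_iUnion, mem_singleton_iff, mem_range]
    constructor
    · rintro (h | ⟨i, rfl⟩)
      · exact Or.inl h
      · exact Or.inr ⟨i.succ, rfl⟩
    · rintro (h | ⟨j, rfl⟩)
      · exact Or.inl h
      · refine Fin.cases (Or.inl ⟨0, hzero, ?_⟩) (fun i => Or.inr ⟨i, rfl⟩) j
        ext i <;> simp [dualShift, minPair_zero (hne _)]
  have hQlat : IsLatticePolytopeV Q := hgen ▸ isLatticePolytopeV_convexHull_liftDual hlat hrefl
  have hNQ : ∀ j, Nhat j = Q + {-dualShift j} := fun j => by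
    rw [hNhat, add_singleton]
    refine Fin.cases ?_ (fun i => ?_) j
    · simp [dualShift]
    · simp [dualShift, sub_eq_add_neg]
  have hN : ∀ j, Nhat j = cayleyDual Δ fun i => if j = i then 1 else 0 := fun j => by
    ext y
    rw [hNQ, hgen, convexHull_liftDual_eq_cayleyDual hc h0, add_singleton]
    constructor
    · rintro ⟨z, hz, rfl⟩
      simpa only [sub_eq_add_neg] using (sub_dualShift_mem_cayleyDual j).2 hz
    · intro hy
      refine ⟨y + dualShift j, ?_, add_neg_cancel_right y _⟩
      rwa [← sub_dualShift_mem_cayleyDual j, add_sub_cancel_right]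
  have hNlat : ∀ j, IsLatticePolytopeV (Nhat j) := fun j => by
    rw [hNQ]
    exact hQlat.add (isLatticePolytopeV_singleton (isLatticePtV_dualShift j).neg)
  have hTlat : ∀ j, IsLatticePolytopeV (Δtilde j) := fun j => by
    rw [hΔtilde]
    exact isLatticePolytopeV_convexHull_union_zero (hlat j) (isLatticePt_evec j)
  have hpair : ∀ i j, ∀ x ∈ Nhat i, ∀ y ∈ Δtilde j,
      -(if i = j then (1 : ℝ) else 0) ≤ pairingV x y := fun i j x hx y hy => by
    rw [hN] at hx
    rw [hΔtilde] at hy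
    rw [pairingV_comm]
    exact neg_le_pairingV_of_mem_cayleyDual hc hne hx (by split_ifs <;> norm_num) hy
  have hNsum : ∑ i, Nhat i = cayleyDual Δ 1 := by
    simp only [hN]
    exact sum_cayleyDual hc hne
  have hpolT : polarDualV (convexHull ℝ (⋃ i, Δtilde i)) = ∑ i, Nhat i := by
    rw [hNsum, hΔtilde]
    exact cayleyDual_one_eq_polarDualV hc hne
  have hUlat : IsLatticePolytopeV (convexHull ℝ (⋃ i, Δtilde i)) :=
    IsLatticePolytopeV.convexHull_iUnion hTlat
  have hTzero : ∀ j, (0 : Vdk d k) ∈ Δtilde j := fun j => by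
    rw [hΔtilde]
    exact subset_convexHull ℝ _ (Or.inr rfl)
  refine ⟨⟨IsLatticePolytopeV.sum hNlat, ?_, ?_⟩, fun i => ⟨hNlat i, ?_⟩, fun j => ?_, ?_, hpolT⟩
  · rw [← hpolT]
    exact hUlat.zero_mem_interior_polarDualV
  · rwa [← hpolT, polarDualV_polarDualV (convex_convexHull ℝ _) hUlat.isClosed
      (subset_convexHull ℝ _ (mem_iUnion.2 ⟨0, hTzero 0⟩))]
  · rw [hN]
    refine (mem_cayleyDual_iff hc hne).2 fun l x _ => ?_
    rw [pairingV_comm, pairingV_zero_left]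
    split_ifs <;> norm_num
  · refine Subset.antisymm (fun y hy => ?_) fun y hy i x hx => hpair i j x hx y hy
    obtain ⟨τ, hτ, x, hx, rfl⟩ := exists_weights_of_le_pairingV hlat h0 fun i z hz =>
      hy i z ((hN i).symm ▸ hz)
    rw [Finset.sum_eq_single_of_mem j (Finset.mem_univ j) fun i _ hij => ?_]
    · rw [hΔtilde]
      exact smul_mem_convexHull_union_zero (mem_image_of_mem _ (hx j)) (hτ j).1
        (by simpa using (hτ j).2)
    · have := hτ i
      rw [if_neg hij] at this
      rw [le_antisymm this.2 this.1, zero_smul]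
  · rw [polarDualV_convexHull]
    refine Subset.antisymm (fun y hy => ?_) fun y hy x hx => ?_
    · obtain ⟨τ, hτ, x, hx, rfl⟩ := exists_weights_of_le_pairingV (b := 1) hlat h0 fun i z hz =>
        hy z (mem_iUnion.2 ⟨i, (hN i).symm ▸ hz⟩)
      refine (mem_fintype_sum _ _).2 ⟨_, fun i => ?_, rfl⟩
      rw [hΔtilde]
      exact smul_mem_convexHull_union_zero (mem_image_of_mem _ (hx i)) (hτ i).1 (hτ i).2
    · obtain ⟨i, hi⟩ := mem_iUnion.1 hx
      obtain ⟨g, hg, rfl⟩ := (mem_fintype_sum _ _).1 hy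
      rw [pairingV_comm, pairingV_sum_left]
      have := Finset.sum_le_sum fun j (_ : j ∈ Finset.univ) => hpair i j x hi (g j) (hg j)
      simpa [pairingV_comm] using this
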